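/- Let S be a quasi-orthodox quasi completely regular semiring and a, b ∈ S. Then the following are equivalent: (i) a 𝒴 b; (ii) there exist e, f, g, h ∈ E⁺(S) with a+0_a = e+b+0_b+f and b+0_b = g+a+0_a+h; (iii) a+0_a = 0_a+b+0_b+0_a and b+0_b = 0_b+a+0_a+0_b. -/

import Mathlib

/-- A "semiring" in the sense of the paper: both reducts are semigroups
(no commutativity, no identities) and multiplication distributes over
addition on both sides. -/
class PSemiring (S : Type*) extends AddSemigroup S, Semigroup S where
  left_distrib : ∀ a b c : S, a * (b + c) = a * b + a * c
  right_distrib : ∀ a b c : S, (a + b) * c = a * c + b * c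

namespace PSemiring

variable {S : Type*} [PSemiring S]

/-- `nmul n a` is the `(n+1)`-fold sum `a + ⋯ + a`; thus the positive
multiple `m·a` of the paper is `nmul (m-1) a`. -/
def nmul : ℕ → S → S
  | 0, a => a
  | n + 1, a => nmul n a + a

/-- `a` is additively regular. -/
def AddRegular (a : S) : Prop := ∃ x, a + x + a = a

/-- `a` is a completely regular element. -/
def CompletelyRegularElem (a : S) : Prop :=
  ∃ x, a = a + x + a ∧ a + x = x + a ∧ a * (a + x) = a + x

/-- `S` is a quasi completely regular semiring. -/
def QuasiCompletelyRegular (S : Type*) [PSemiring S] : Prop :=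
  ∀ a : S, ∃ n : ℕ, CompletelyRegularElem (nmul n a)

/-- `S` is a completely regular semiring. -/
def CompletelyRegularSemiring (S : Type*) [PSemiring S] : Prop :=
  ∀ a : S, CompletelyRegularElem a

/-- `e` is an additive idempotent (i.e. `e ∈ E⁺(S)`). -/
def AddIdem (e : S) : Prop := e + e = e

/-- `V⁺(a)`, the set of additive inverses of `a`. -/
def Vplus (a : S) : Set S := {x | a + x + a = a ∧ x + a + x = x}

/-- `{a} ∪ (S + a)`. -/
def lset (a : S) : Set S := insert a {x | ∃ s, x = s + a}

/-- `{a} ∪ (a + S)`. -/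
def rset (a : S) : Set S := insert a {x | ∃ s, x = a + s}

/-- `{a} ∪ (S + a) ∪ (a + S) ∪ (S + a + S)`. -/
def jset (a : S) : Set S :=
  insert a ({x | ∃ s, x = s + a} ∪ {x | ∃ s, x = a + s} ∪ {x | ∃ s t, x = s + a + t})

/-- Green's relation `L⁺` on the additive reduct. -/
def GreenL (a b : S) : Prop := lset a = lset b

/-- Green's relation `R⁺` on the additive reduct. -/
def GreenR (a b : S) : Prop := rset a = rset b

/-- Green's relation `J⁺` on the additive reduct. -/
def GreenJ (a b : S) : Prop := jset a = jset b

/-- `n` is the least index such that the `(n+1)`-fold sum of `a` is additively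
regular, i.e. `(n+1)·a` is the least additively regular positive multiple. -/
def LeastReg (a : S) (n : ℕ) : Prop :=
  AddRegular (nmul n a) ∧ ∀ m < n, ¬ AddRegular (nmul m a)

/-- The relation `L*⁺`. -/
def LStar (a b : S) : Prop :=
  ∃ p q, LeastReg a p ∧ LeastReg b q ∧ GreenL (nmul p a) (nmul q b)

/-- The relation `R*⁺`. -/
def RStar (a b : S) : Prop :=
  ∃ p q, LeastReg a p ∧ LeastReg b q ∧ GreenR (nmul p a) (nmul q b)

/-- The relation `J*⁺`. -/
def JStar (a b : S) : Prop :=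
  ∃ p q, LeastReg a p ∧ LeastReg b q ∧ GreenJ (nmul p a) (nmul q b)

/-- `H*⁺ = L*⁺ ∩ R*⁺`. -/
def HStar (a b : S) : Prop := LStar a b ∧ RStar a b

/-- `D*⁺ = L*⁺ ∘ R*⁺` (relational composition). -/
def DStar (a b : S) : Prop := ∃ c, LStar a c ∧ RStar c b

/-- `z = 0_a`: `z = na + x` where `n` is the least positive integer with `na`
completely regular and `x` is the (unique) element with `na = na+x+na`,
`x = x+na+x` and `na+x = x+na`. -/
def IsZeroOf (a z : S) : Prop :=
  ∃ n x, (CompletelyRegularElem (nmul n a) ∧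
      ∀ m < n, ¬ CompletelyRegularElem (nmul m a)) ∧
    nmul n a = nmul n a + x + nmul n a ∧ x = x + nmul n a + x ∧
    nmul n a + x = x + nmul n a ∧ z = nmul n a + x

/-- The relation `𝒴`, relative to a choice `z` of the map `a ↦ 0_a`. -/
def Yrel (z : S → S) (a b : S) : Prop := Vplus (a + z a) = Vplus (b + z b)

/-- A (semiring) congruence. -/
structure IsCong (r : S → S → Prop) : Prop where
  refl : ∀ a, r a a
  symm : ∀ {a b}, r a b → r b a
  trans : ∀ {a b c}, r a b → r b c → r a c
  addl : ∀ (c : S) {a b}, r a b → r (c + a) (c + b)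
  addr : ∀ (c : S) {a b}, r a b → r (a + c) (b + c)
  mull : ∀ (c : S) {a b}, r a b → r (c * a) (c * b)
  mulr : ∀ (c : S) {a b}, r a b → r (a * c) (b * c)

/-- `r` is a b-lattice congruence: `S/r` is a b-lattice. -/
def IsBLatticeCong (r : S → S → Prop) : Prop :=
  IsCong r ∧ (∀ a : S, r (a * a) a) ∧ (∀ a : S, r (a + a) a) ∧
    ∀ a b : S, r (a + b) (b + a)

/-- `r` is the least b-lattice congruence. -/
def IsLeastBLatticeCong (r : S → S → Prop) : Prop :=
  IsBLatticeCong r ∧ ∀ r', IsBLatticeCong r' → ∀ a b, r a b → r' a b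

/-- `r` is a skew-ring congruence: `S/r` is a semiring whose additive reduct
is a group (expressed by solvability of both translation equations). -/
def IsSkewRingCong (r : S → S → Prop) : Prop :=
  IsCong r ∧ ∀ a b : S, (∃ x, r (a + x) b) ∧ ∃ y, r (y + a) b

/-- `r` is the least skew-ring congruence. -/
def IsLeastSkewRingCong (r : S → S → Prop) : Prop :=
  IsSkewRingCong r ∧ ∀ r', IsSkewRingCong r' → ∀ a b, r a b → r' a b

/-- `η` is a b-lattice-of-skew-rings congruence: `S/η` admits a congruence `ξ`
(given here as a congruence on `S` containing `η`) such that `(S/η)/ξ` is a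
b-lattice and every `ξ`-class of `S/η` is a subsemiring whose additive reduct
is a group. -/
def IsBLSRCong (η : S → S → Prop) : Prop :=
  IsCong η ∧ ∃ ξ : S → S → Prop, IsCong ξ ∧ (∀ a b, η a b → ξ a b) ∧
    (∀ a : S, ξ (a * a) a) ∧ (∀ a : S, ξ (a + a) a) ∧
    (∀ a b : S, ξ (a + b) (b + a)) ∧
    (∀ a b, ξ a b → ξ (a + b) a ∧ ξ (a * b) a) ∧
    ∀ a b, ξ a b → (∃ x, ξ x a ∧ η (a + x) b) ∧ ∃ y, ξ y a ∧ η (y + a) b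

/-- `ν` is the least b-lattice-of-skew-rings congruence. -/
def IsLeastBLSRCong (ν : S → S → Prop) : Prop :=
  IsBLSRCong ν ∧ ∀ η, IsBLSRCong η → ∀ a b, ν a b → η a b

/-- `r` is a completely regular semiring congruence: `S/r` is completely
regular. -/
def IsCRCong (r : S → S → Prop) : Prop :=
  IsCong r ∧ ∀ a : S, ∃ x, r a (a + x + a) ∧ r (a + x) (x + a) ∧
    r (a * (a + x)) (a + x)

/-- `ρ` is the least completely regular semiring congruence. -/
def IsLeastCRCong (r : S → S → Prop) : Prop :=
  IsCRCong r ∧ ∀ r', IsCRCong r' → ∀ a b, r a b → r' a b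

/-- `S` is quasi-orthodox. -/
def QuasiOrthodox (S : Type*) [PSemiring S] : Prop :=
  ∀ e f : S, AddIdem e → AddIdem f →
    ∃ n : ℕ, nmul n (e + f) = nmul (n + 1) (e + f)

/-- `S` is a completely Archimedean semiring. -/
def CompletelyArchimedean (S : Type*) [PSemiring S] : Prop :=
  QuasiCompletelyRegular S ∧ ∀ a b : S, JStar a b

/-- `r` is the least congruence containing the relation `τ`. -/
def IsLeastCongContaining (τ r : S → S → Prop) : Prop :=
  IsCong r ∧ (∀ a b, τ a b → r a b) ∧
    ∀ r', IsCong r' → (∀ a b, τ a b → r' a b) → ∀ a b, r a b → r' a b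

/-- `r` is a generalized additive idempotent pure congruence (purity part). -/
def GenAddIdemPure (r : S → S → Prop) : Prop :=
  ∀ a e : S, AddIdem e → r a e → ∃ n : ℕ, nmul n a = nmul (n + 1) a

/-- `τ^e`: `a = x + c + y`, `b = x + d + y` for some `(c,d) ∈ τ`, where each of
`x`, `y` may also be absent (i.e. `x, y ∈ S⁰`). -/
def relE (τ : S → S → Prop) (a b : S) : Prop :=
  ∃ c d, τ c d ∧ ((a = c ∧ b = d) ∨ (∃ x, a = x + c ∧ b = x + d) ∨
    (∃ y, a = c + y ∧ b = d + y) ∨ ∃ x y, a = x + c + y ∧ b = x + d + y)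

/-- `τ^♮`: the transitive closure of `(τ ∪ τ⁻¹ ∪ ε)^e`. -/
def natClosure (τ : S → S → Prop) : S → S → Prop :=
  Relation.TransGen (relE (fun a b => τ a b ∨ τ b a ∨ a = b))

end PSemiring

open PSemiring

namespace PSemiring

variable {S : Type*} [PSemiring S]

lemma nmul_of_addIdem {e : S} (he : AddIdem e) (n : ℕ) : nmul n e = e := by
  induction n with
  | zero => rfl
  | succ n ih => rw [nmul, ih, he]

lemma mul_nmul (n : ℕ) (a b : S) : a * nmul n b = nmul n (a * b) := by
  induction n with
  | zero => rfl
  | succ n ih => rw [nmul, left_distrib, ih, nmul]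

lemma nmul_mul (n : ℕ) (a b : S) : nmul n a * b = nmul n (a * b) := by
  induction n with
  | zero => rfl
  | succ n ih => rw [nmul, right_distrib, ih, nmul]

lemma addIdem_mul_left (a : S) {e : S} (he : AddIdem e) : AddIdem (a * e) := by
  rw [AddIdem, ← left_distrib, he]

lemma addIdem_mul_right {e : S} (he : AddIdem e) (a : S) : AddIdem (e * a) := by
  rw [AddIdem, ← right_distrib, he]

lemma add_nmul_comm (n : ℕ) (a : S) : a + nmul n a = nmul n a + a := by
  induction n with
  | zero => rfl
  | succ n ih => rw [nmul, ← add_assoc, ih]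

lemma exists_nmul_add_nmul_eq (n : ℕ) (a : S) :
    ∃ w, nmul n a + nmul n a = a + w ∧ nmul n a + nmul n a = w + a := by
  cases n with
  | zero => exact ⟨a, rfl, rfl⟩
  | succ n =>
    have h := add_nmul_comm n a
    refine ⟨nmul n a + nmul (n + 1) a, ?_, ?_⟩
    · simp only [nmul, ← add_assoc, h]
    · simp only [nmul, ← add_assoc]
      rw [add_assoc (nmul n a) a, h, ← add_assoc]

omit [PSemiring S] in
lemma add_add_of_eq [AddSemigroup S] {a b c : S} (h : a + b = c) (t : S) :
    a + (b + t) = c + t := by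
  rw [← add_assoc, h]

/-- `a` lies in an additive subgroup with identity `z`, and `r` is its inverse there. -/
structure IsGroupInv (a z r : S) : Prop where
  idem : z + z = z
  add_zero : a + z = a
  zero_add : z + a = a
  add_inv : a + r = z
  inv_add : r + a = z
  zero_add_inv : z + r = r

lemma exists_isGroupInv_add (n : ℕ) {a x : S} (h : nmul n a = nmul n a + x + nmul n a)
    (hc : nmul n a + x = x + nmul n a) :
    ∃ r, IsGroupInv (a + (nmul n a + x)) (nmul n a + x) r := by
  have hN := add_nmul_comm n a
  obtain ⟨w, hw, hw'⟩ := exists_nmul_add_nmul_eq n a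
  generalize nmul n a = N at *
  generalize hz : N + x = z at *
  have hzN : z + N = N := h.symm
  have hNz : N + z = N := by rw [hc, ← add_assoc, hz, hzN]
  have hzz : z + z = z := by
    nth_rw 2 [← hz]
    rw [← add_assoc, hzN, hz]
  have h1 : z + (a + z) = a + z := by
    rw [← hz, ← add_assoc a, hN, add_assoc N a, ← add_assoc, hz, ← add_assoc, hzN, add_assoc]
  have h2 : z + (a + z) = z + a := by
    rw [hc, add_assoc x, ← add_assoc N, ← hN, add_assoc a, ← hc, hNz, hN, ← add_assoc, ← hc]
  have haz : z + a = a + z := h2.symm.trans h1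
  have hr : (a + z) + (w + (x + x)) = z := by
    simp only [← haz, add_assoc, add_add_of_eq hw.symm, add_add_of_eq hz, add_add_of_eq hNz,
      hz, hzz]
  have hl : ((x + x) + w) + (a + z) = z := by
    simp only [add_assoc, add_add_of_eq hw'.symm, add_add_of_eq hc.symm, hNz, hzN, ← hc]
  have haz' : a + z + z = a + z := by rw [add_assoc, hzz]
  generalize a + z = A at *
  generalize w + (x + x) = r at *
  generalize (x + x) + w = l at *
  have hlr : z + r = l + z := by rw [← hr, ← add_assoc, hl, hr]
  exact ⟨z + r, hzz, haz', h1, by rw [← add_assoc, haz', hr], by rw [hlr, add_assoc, h1, hl],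
    by rw [← add_assoc, hzz]⟩

variable (hS : QuasiCompletelyRegular S)
include hS

lemma mul_self_of_addIdem {e : S} (he : AddIdem e) : e * e = e := by
  obtain ⟨n, x, h1, h2, h3⟩ := hS e
  rw [nmul_of_addIdem he] at h1 h2 h3
  have : e + x = e := by unfold AddIdem at he; grind
  rwa [this] at h3

/-- Every additively regular element lies in an additive subgroup. -/
lemma AddRegular.exists_isGroupInv {x : S} (hx : AddRegular x) : ∃ z r, IsGroupInv x z r := by
  obtain ⟨y', hy'⟩ := hx
  obtain ⟨y, hy, hxy⟩ : ∃ y, x + y + x = x ∧ y + x + y = y := ⟨y' + x + y', by grind, by grind⟩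
  obtain ⟨n, t, h1, h2, h3⟩ := hS x
  obtain ⟨r, hr⟩ := exists_isGroupInv_add n h1 h2
  generalize hz : nmul n x + t = z at *
  have hxz : x * z = z := by
    rwa [nmul_mul, nmul_of_addIdem (addIdem_mul_left x hr.idem)] at h3
  have he : AddIdem (x + y) := by unfold AddIdem; grind
  have hf : AddIdem (y + x) := by unfold AddIdem; grind
  have hee := mul_self_of_addIdem hS he
  have hff := mul_self_of_addIdem hS hf
  have heN : (x + y) * nmul n x = (x + y) * x := by
    rw [mul_nmul, nmul_of_addIdem (addIdem_mul_right he x)]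
  have hfN : (y + x) * nmul n x = (y + x) * x := by
    rw [mul_nmul, nmul_of_addIdem (addIdem_mul_right hf x)]
  have hzN : z + nmul n x = nmul n x := by grind
  have hNz : nmul n x + z = nmul n x := by grind
  have hz_idem := hr.idem
  have hez : z + (x + y) = x + y := by
    have h4 : (x + y) * x = z + y * z + (x + y) * x := by
      conv_lhs => rw [← heN, ← hzN, left_distrib, heN, right_distrib x y z, hxz]
    have h5 : z + (x + y) * x = (x + y) * x := by grind
    rw [left_distrib] at hee
    grind
  have hfz : (y + x) + z = y + x := by
    have h4 : (y + x) * x = (y + x) * x + (y * z + z) := by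
      conv_lhs => rw [← hfN, ← hNz, left_distrib, hfN, right_distrib y x z, hxz]
    have h5 : (y + x) * x + z = (y + x) * x := by grind
    rw [left_distrib] at hff
    calc (y + x) + z = ((y + x) * y + (y + x) * x) + z := by rw [hff]
      _ = y + x := by rw [add_assoc, h5, hff]
  have hx_add : x + z = x := by
    calc x + z = x + (y + x) + z := by rw [← add_assoc, hy]
      _ = x := by rw [add_assoc, hfz, ← add_assoc, hy]
  rw [hx_add] at hr
  exact ⟨z, r, hr⟩

lemma exists_eq_add_right {p s v t : S} (hp : AddIdem p) (h : p = s + v + t) :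
    ∃ r, p = p + v + r := by
  have h1 : (p + s) + (v + t + p) = p := by
    calc (p + s) + (v + t + p) = p + (s + v + t) + p := by simp only [add_assoc]
      _ = p := by rw [← h, hp, hp]
  obtain ⟨z, r, hr⟩ : ∃ z r, IsGroupInv (v + t + p) z r :=
    AddRegular.exists_isGroupInv hS ⟨p + s, by rw [add_assoc, h1, add_assoc, hp]⟩
  refine ⟨t + p + r, ?_⟩
  calc p = (p + s) + (v + t + p + z) := by rw [hr.add_zero, h1]
    _ = p + (v + t + p + r) := by rw [← add_assoc, h1, hr.add_inv]
    _ = p + v + (t + p + r) := by simp only [add_assoc]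

lemma exists_eq_add_left {p s v t : S} (hp : AddIdem p) (h : p = s + v + t) :
    ∃ r, p = r + v + p := by
  have h1 : (p + s + v) + (t + p) = p := by
    calc (p + s + v) + (t + p) = p + (s + v + t) + p := by simp only [add_assoc]
      _ = p := by rw [← h, hp, hp]
  obtain ⟨z, r, hr⟩ : ∃ z r, IsGroupInv (p + s + v) z r :=
    AddRegular.exists_isGroupInv hS ⟨t + p, by rw [h1, ← add_assoc, ← add_assoc, hp]⟩
  refine ⟨r + p + s, ?_⟩
  calc p = z + (p + s + v) + (t + p) := by rw [hr.zero_add, h1]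
    _ = r + (p + s + v) + p := by rw [add_assoc, h1, hr.inv_add]
    _ = r + p + s + v + p := by simp only [add_assoc]

lemma addIdem_of_nmul_eq {a : S} (ha : AddRegular a) {n : ℕ}
    (h : nmul n a = nmul (n + 1) a) : AddIdem a := by
  obtain ⟨z, r, hr⟩ := AddRegular.exists_isGroupInv hS ha
  obtain ⟨-, h1, h2, h3, h4, -⟩ := hr
  induction n with
  | zero => exact h.symm
  | succ n ih =>
    refine ih ?_
    have h5 : nmul (n + 1) a + r = nmul (n + 1) a + a + r := congrArg (· + r) h
    rw [add_assoc _ a r, h3, nmul, add_assoc _ a r, h3, add_assoc _ a z, h1] at h5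
    cases n with
    | zero => simp only [nmul] at *; rwa [h1] at h5
    | succ n => simp only [nmul] at *; rwa [add_assoc _ a z, h1] at h5

variable (hqo : QuasiOrthodox S)
include hqo

lemma addIdem_add_right {p e s t : S} (hp : AddIdem p) (he : AddIdem e) (h : p = s + e + t) :
    AddIdem (p + e) := by
  obtain ⟨r, hr⟩ := exists_eq_add_right hS hp h
  obtain ⟨n, hn⟩ := hqo p e hp he
  unfold AddIdem at hp
  exact addIdem_of_nmul_eq hS ⟨r, by grind⟩ hn

lemma addIdem_add_left {p e s t : S} (hp : AddIdem p) (he : AddIdem e) (h : p = s + e + t) :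
    AddIdem (e + p) := by
  obtain ⟨r, hr⟩ := exists_eq_add_left hS hp h
  obtain ⟨n, hn⟩ := hqo e p he hp
  unfold AddIdem at hp
  exact addIdem_of_nmul_eq hS ⟨r, by grind⟩ hn

lemma addIdem_sandwich {p e s t : S} (hp : AddIdem p) (he : AddIdem e) (h : p = s + e + t) :
    p + e + p = p := by
  obtain ⟨r, hr⟩ := exists_eq_add_right hS hp h
  have := addIdem_add_right hS hqo hp he h
  unfold AddIdem at this hp
  grind

lemma eq_zero_add_add_zero {A B p q r r' e f g h : S}
    (hA : IsGroupInv A p r) (hB : IsGroupInv B q r')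
    (he : AddIdem e) (hf : AddIdem f) (hAB : A = e + B + f) (hBA : B = g + A + h) :
    A = p + B + p := by
  have h1 : q = g + (e + B + f) + h + r' := by rw [← hAB, ← hBA, hB.add_inv]
  have h2 : q = r' + (g + (e + B + f) + h) := by rw [← hAB, ← hBA, hB.inv_add]
  have hB₁ := add_add_of_eq hB.zero_add
  have hB₂ := add_add_of_eq hB.add_zero
  have hqp : q + p + q = q :=
    addIdem_sandwich hS hqo (s := g) (t := A + h + r') hB.idem hA.idem <| by
      rw [add_assoc g, ← add_assoc p, ← add_assoc p, hA.zero_add, ← add_assoc, ← add_assoc,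
        ← hBA, hB.add_inv]
  have heq : AddIdem (e + q) :=
    addIdem_add_left hS hqo (s := g) (t := B + f + h + r') hB.idem he
      (by simpa only [add_assoc] using h1)
  have hqf : AddIdem (q + f) :=
    addIdem_add_right hS hqo (s := r' + g + e + B) (t := h) hB.idem hf
      (by simpa only [add_assoc] using h2)
  have hl : p + (e + q) + p = p :=
    addIdem_sandwich hS hqo (s := r) (t := B + f) hA.idem heq <| by
      simp only [add_assoc, hB₁]
      rw [← add_assoc e, ← hAB, hA.inv_add]
  have hr : p + (q + f) + p = p :=
    addIdem_sandwich hS hqo (s := e + B) (t := r) hA.idem hqf <| by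
      rw [← add_assoc, add_assoc e, hB.add_zero, ← hAB, hA.add_inv]
  have hl' : p + e + q = p + q := by
    calc p + e + q = p + e + (q + p + q) := by rw [hqp]
      _ = (p + (e + q) + p) + q := by simp only [add_assoc]
      _ = p + q := by rw [hl]
  have hr' : q + f + p = q + p := by
    calc q + f + p = (q + p + q) + f + p := by rw [hqp]
      _ = q + (p + (q + f) + p) := by simp only [add_assoc]
      _ = q + p := by rw [hr]
  calc A = p + (e + B + f) + p := by rw [← hAB, hA.zero_add, hA.add_zero]
    _ = (p + e + q) + B + (q + f + p) := by simp only [add_assoc, hB₁, hB₂]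
    _ = p + B + p := by rw [hl', hr']; simp only [add_assoc, hB₁, hB₂]

lemma vplus_subset {A B p q r : S} (hB : IsGroupInv B q r) (hAB : A = p + B + p)
    (hBA : B = q + A + q) : Vplus A ⊆ Vplus B := by
  rintro x ⟨hx, hx'⟩
  have hB₁ := add_add_of_eq hB.zero_add
  have hv : (x + A) + q + (x + A) = x + A :=
    addIdem_sandwich hS hqo (s := x + p) (t := B + p) (by rw [AddIdem, ← add_assoc, hx'])
      hB.idem (by simpa only [add_assoc, hB₁] using congrArg (x + ·) hAB)
  have hu : (A + x) + q + (A + x) = A + x :=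
    addIdem_sandwich hS hqo (s := p) (t := B + p + x) (by rw [AddIdem, ← add_assoc, hx])
      hB.idem (by simpa only [add_assoc, hB₁] using congrArg (· + x) hAB)
  have h1 : A + q + x = A + x := by
    calc A + q + x = (A + x + A) + q + (x + A + x) := by rw [hx, hx']
      _ = A + ((x + A) + q + (x + A)) + x := by simp only [add_assoc]
      _ = A + x := by rw [hv, ← add_assoc, hx]
  have h2 : x + q + A = x + A := by
    calc x + q + A = (x + A + x) + q + (A + x + A) := by rw [hx, hx']
      _ = x + ((A + x) + q + (A + x)) + A := by simp only [add_assoc]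
      _ = x + A := by rw [hu, ← add_assoc, hx']
  constructor
  · calc B + x + B = (q + A + q) + x + (q + A + q) := by rw [← hBA]
      _ = q + (A + q + x) + q + A + q := by simp only [add_assoc]
      _ = q + A + (x + q + A) + q := by rw [h1]; simp only [add_assoc]
      _ = q + (A + x + A) + q := by rw [h2]; simp only [add_assoc]
      _ = B := by rw [hx, ← hBA]
  · calc x + B + x = x + (q + A + q) + x := by rw [← hBA]
      _ = (x + q + A) + q + x := by simp only [add_assoc]
      _ = x + (A + q + x) := by rw [h2]; simp only [add_assoc]
      _ = x := by rw [h1, ← add_assoc, hx']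

omit hS hqo in
lemma eq_zero_add_add_zero_of_mem_vplus {A B p r : S} (hA : IsGroupInv A p r)
    (h : r ∈ Vplus B) : A = p + B + p := by
  calc A = A + (r + B + r) + A := by rw [h.2, hA.add_inv, hA.zero_add]
    _ = (A + r) + B + (r + A) := by simp only [add_assoc]
    _ = p + B + p := by rw [hA.add_inv, hA.inv_add]

omit hS hqo in
lemma IsGroupInv.mem_vplus {A p r : S} (hA : IsGroupInv A p r) : r ∈ Vplus A :=
  ⟨by rw [hA.add_inv, hA.zero_add], by rw [hA.inv_add, hA.zero_add_inv]⟩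

omit hS hqo in
lemma IsZeroOf.exists_isGroupInv {a z : S} (h : IsZeroOf a z) : ∃ r, IsGroupInv (a + z) z r := by
  obtain ⟨n, x, -, h1, -, h2, rfl⟩ := h
  exact exists_isGroupInv_add n h1 h2

end PSemiring

/-- In a quasi-orthodox quasi completely regular semiring, for
`a b : S` the following are equivalent: (i) `a 𝒴 b`; (ii) `∃ e f g h ∈ E⁺(S)`
with `a+0_a = e+b+0_b+f` and `b+0_b = g+a+0_a+h`; (iii) `a+0_a = 0_a+b+0_b+0_a`
and `b+0_b = 0_b+a+0_a+0_b`. -/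
theorem yrel_tfae {S : Type*} [PSemiring S]
    (hS : QuasiCompletelyRegular S) (hqo : QuasiOrthodox S)
    (z : S → S) (hz : ∀ a, IsZeroOf a (z a)) (a b : S) :
    (Yrel z a b ↔ ∃ e f g h : S, AddIdem e ∧ AddIdem f ∧ AddIdem g ∧
        AddIdem h ∧ a + z a = e + b + z b + f ∧ b + z b = g + a + z a + h) ∧
    (Yrel z a b ↔ (a + z a = z a + b + z b + z a ∧
        b + z b = z b + a + z a + z b)) := by
  obtain ⟨r, hA⟩ := (hz a).exists_isGroupInv
  obtain ⟨r', hB⟩ := (hz b).exists_isGroupInv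
  rw [add_assoc (z a) b, add_assoc (z b) a]
  have h13 : Yrel z a b → a + z a = z a + (b + z b) + z a ∧ b + z b = z b + (a + z a) + z b :=
    fun h ↦ ⟨eq_zero_add_add_zero_of_mem_vplus hA (h ▸ hA.mem_vplus),
      eq_zero_add_add_zero_of_mem_vplus hB (h ▸ hB.mem_vplus)⟩
  have h31 : a + z a = z a + (b + z b) + z a ∧ b + z b = z b + (a + z a) + z b → Yrel z a b :=
    fun ⟨h, h'⟩ ↦ (vplus_subset hS hqo hB h h').antisymm (vplus_subset hS hqo hA h' h)
  refine ⟨⟨fun h ↦ ?_, ?_⟩, h13, h31⟩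
  · obtain ⟨h, h'⟩ := h13 h
    rw [← add_assoc] at h h'
    exact ⟨z a, z a, z b, z b, hA.idem, hA.idem, hB.idem, hB.idem, h, h'⟩
  · rintro ⟨e, f, g, h, he, hf, hg, hh, hab, hba⟩
    rw [add_assoc e b] at hab
    rw [add_assoc g a] at hba
    exact h31 ⟨eq_zero_add_add_zero hS hqo hA hB he hf hab hba,
      eq_zero_add_add_zero hS hqo hB hA hg hh hba hab⟩
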